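/- Let N, m be positive integers with gcd(m,N) = 1, k a positive even integer, f : ℍ → ℂ, and ε ∈ {+1,−1}. Suppose f|_k P = f, f|_k H_N = ε f, and for each prime p dividing m there is α_p ∈ ℂ with f|_k T_p = α_p f. For each b with 1 ≤ b ≤ m and gcd(b,m) = 1, choose integers c_b, n_b with m·n_b − b·c_b·N = 1 and set γ_b = ((m,−b),(−N c_b, n_b)) ∈ Γ₀(N). Then Σ_{1≤b≤m, gcd(b,m)=1} [ f|_k β(b/m) − f|_k ( γ_b · β(b/m) ) ] = 0. (Corollary 2.) -/

import Mathlib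

open UpperHalfPlane Matrix Complex MatrixGroups Asymptotics Filter Topology
open scoped Manifold

set_option synthInstance.maxHeartbeats 1000000 in
/-- Action of a real 2×2 matrix with positive determinant on the upper
half-plane `ℍ` (junk value `z` if the determinant is not positive). -/
noncomputable def glAct (γ : Matrix (Fin 2) (Fin 2) ℝ) (z : ℍ) : ℍ :=
  if h : 0 < γ.det then
    (⟨Matrix.GeneralLinearGroup.mkOfDetNeZero γ h.ne', by
        simpa [Matrix.GeneralLinearGroup.mkOfDetNeZero] using h⟩ : GL(2, ℝ)⁺) • z
  else z

/-- For an even integer `k`, the weight-`k` slash action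
`(f ∣ₖ γ)(z) = (det γ)^(k/2) (cz+d)^(-k) f(γz)`. -/
noncomputable def slash (k : ℤ) (γ : Matrix (Fin 2) (Fin 2) ℝ) (f : ℍ → ℂ) : ℍ → ℂ :=
  fun z => (γ.det : ℂ) ^ (k / 2) * (γ 1 0 * (z : ℂ) + γ 1 1) ^ (-k) * f (glAct γ z)

/-- An element of `SL(2, ℤ)` as a real matrix. -/
def sl2ToReal (γ : Matrix.SpecialLinearGroup (Fin 2) ℤ) : Matrix (Fin 2) (Fin 2) ℝ :=
  (γ : Matrix (Fin 2) (Fin 2) ℤ).map (Int.cast)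

/-- The function `f(z) = Σ_{n ≥ 1} a_n e^{2πinz}` on the upper half-plane. -/
noncomputable def fourierSeries (a : ℕ → ℂ) : ℍ → ℂ :=
  fun z => ∑' n : ℕ, a (n + 1) *
    Complex.exp (2 * (Real.pi : ℂ) * Complex.I * ((n : ℂ) + 1) * (z : ℂ))

/-- The Dirichlet series `F(s) = Σ_{n ≥ 1} a_n n^{-s}`. -/
noncomputable def dirichletSeries (a : ℕ → ℂ) (s : ℂ) : ℂ :=
  ∑' n : ℕ, a (n + 1) / ((n : ℂ) + 1) ^ s

/-- The action of the Hecke operator `T_p` in weight `k`: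
`f|_k T_p = f|_k ((p,0),(0,1)) + Σ_{b=0}^{p-1} f|_k ((1,b),(0,p))`. -/
noncomputable def heckeT (k : ℤ) (p : ℕ) (f : ℍ → ℂ) : ℍ → ℂ :=
  fun z => slash k !![(p : ℝ), 0; 0, 1] f z +
    ∑ b ∈ Finset.range p, slash k !![1, (b : ℝ); 0, (p : ℝ)] f z

/-- The action of the Atkin–Lehner operator `U_q` in weight `k`:
`f|_k U_q = Σ_{b=0}^{q-1} f|_k ((q,b),(0,q))`. -/
noncomputable def atkinLehnerU (k : ℤ) (q : ℕ) (f : ℍ → ℂ) : ℍ → ℂ :=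
  fun z => ∑ b ∈ Finset.range q, slash k !![(q : ℝ), (b : ℝ); 0, (q : ℝ)] f z

/-- The local factor at the prime `p` of an Euler product of degree 2,
level `N`, and weight `k`. -/
noncomputable def localFactor (a : ℕ → ℂ) (N : ℕ) (k : ℤ) (p : ℕ) (s : ℂ) : ℂ :=
  if p ∣ N then
    (if p ^ 2 ∣ N then 1 else (1 - (p : ℂ) ^ ((k : ℂ) / 2 - 1 - s))⁻¹)
  else (1 - a p * (p : ℂ) ^ (-s) + (p : ℂ) ^ ((k : ℂ) - 1 - 2 * s))⁻¹

theorem denom_ne_zero_of_det_pos {γ : Matrix (Fin 2) (Fin 2) ℝ} (h : 0 < γ.det) (z : ℍ) :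
    (γ 1 0 * (z : ℂ) + γ 1 1 : ℂ) ≠ 0 :=
  UpperHalfPlane.denom_ne_zero (Matrix.GeneralLinearGroup.mkOfDetNeZero γ h.ne') z

theorem coe_glAct {γ : Matrix (Fin 2) (Fin 2) ℝ} (h : 0 < γ.det) (z : ℍ) :
    (glAct γ z : ℂ) = (γ 0 0 * (z : ℂ) + γ 0 1) / (γ 1 0 * (z : ℂ) + γ 1 1) := by
  have hdet : 0 < (Matrix.GeneralLinearGroup.mkOfDetNeZero γ h.ne').det.val := by
    simpa [Matrix.GeneralLinearGroup.mkOfDetNeZero] using h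
  rw [glAct, dif_pos h]
  exact UpperHalfPlane.coe_smul_of_det_pos hdet z

/-- The slash action by a fixed matrix, as a linear map. -/
noncomputable def slashLin (k : ℤ) (γ : Matrix (Fin 2) (Fin 2) ℝ) : (ℍ → ℂ) →ₗ[ℂ] (ℍ → ℂ) where
  toFun := slash k γ
  map_add' f g := by ext z; simp [slash, mul_add]
  map_smul' c f := by ext z; simp [slash]; ring

theorem slashLin_apply (k : ℤ) (γ : Matrix (Fin 2) (Fin 2) ℝ) (f : ℍ → ℂ) :
    slashLin k γ f = slash k γ f := rfl

theorem slashLin_mul (k : ℤ) {A B : Matrix (Fin 2) (Fin 2) ℝ} (hA : 0 < A.det) (hB : 0 < B.det)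
    (f : ℍ → ℂ) : slashLin k B (slashLin k A f) = slashLin k (A * B) f := by
  have hAB : 0 < (A * B).det := by rw [Matrix.det_mul]; positivity
  ext z
  have hz := denom_ne_zero_of_det_pos hB z
  have hw := denom_ne_zero_of_det_pos hA (glAct B z)
  have hBz : (glAct B z : ℂ) * (B 1 0 * (z : ℂ) + B 1 1) = B 0 0 * (z : ℂ) + B 0 1 := by
    rw [coe_glAct hB, div_mul_cancel₀ _ hz]
  have hact : glAct (A * B) z = glAct A (glAct B z) := by
    apply UpperHalfPlane.ext
    have h := denom_ne_zero_of_det_pos hAB z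
    rw [coe_glAct hAB, coe_glAct hA, div_eq_div_iff h hw]
    simp only [Matrix.mul_apply, Fin.sum_univ_two]
    push_cast
    linear_combination (-(A 0 0 : ℂ) * (A 1 0 * (glAct B z : ℂ) + A 1 1) +
      (A 0 0 * (glAct B z : ℂ) + A 0 1) * A 1 0) * hBz
  have hcocycle : ((A * B) 1 0 * (z : ℂ) + (A * B) 1 1 : ℂ) =
      (A 1 0 * (glAct B z : ℂ) + A 1 1) * (B 1 0 * (z : ℂ) + B 1 1) := by
    simp only [Matrix.mul_apply, Fin.sum_univ_two]
    push_cast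
    linear_combination -(A 1 0 : ℂ) * hBz
  simp only [slashLin_apply, slash, hact, hcocycle, Matrix.det_mul, Complex.ofReal_mul, mul_zpow]
  ring

theorem slashLin_smul_matrix {k : ℤ} (hk : Even k) {c : ℝ} (hc : c ≠ 0)
    {A : Matrix (Fin 2) (Fin 2) ℝ} (hA : 0 < A.det) (f : ℍ → ℂ) :
    slashLin k (c • A) f = slashLin k A f := by
  have hcA : 0 < (c • A).det := by rw [Matrix.det_smul]; simp; positivity
  have hc' : (c : ℂ) ≠ 0 := by exact_mod_cast hc
  ext z
  have hz := denom_ne_zero_of_det_pos hA z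
  have hden : ((c • A) 1 0 * (z : ℂ) + (c • A) 1 1 : ℂ) = c * (A 1 0 * (z : ℂ) + A 1 1) := by
    simp; ring
  have hact : glAct (c • A) z = glAct A z := by
    apply UpperHalfPlane.ext
    rw [coe_glAct hcA, coe_glAct hA, hden]
    simp
    field_simp
  obtain ⟨l, rfl⟩ := hk
  have hl : (l + l) / 2 = l := by omega
  simp only [slashLin_apply, slash, hact, hden, mul_zpow, Matrix.det_smul, Fintype.card_fin, hl,
    Complex.ofReal_mul, Complex.ofReal_pow]
  rw [← zpow_natCast, ← _root_.zpow_mul]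
  have : (c : ℂ) ^ (((2 : ℕ) : ℤ) * l) * (c : ℂ) ^ (-(l + l)) = 1 := by
    rw [← zpow_add₀ hc']
    convert zpow_zero _
    push_cast; ring
  linear_combination (A.det : ℂ) ^ l * (A 1 0 * (z : ℂ) + A 1 1) ^ (-(l + l)) * f (glAct A z) * this

theorem slashLin_one (k : ℤ) (f : ℍ → ℂ) : slashLin k 1 f = f := by
  ext z
  have hact : glAct 1 z = z := by
    apply UpperHalfPlane.ext
    rw [coe_glAct (by simp)]
    simp
  simp [slashLin_apply, slash, hact]

/-- The translation matrix `((1,x),(0,1))`. -/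
def translation (x : ℝ) : Matrix (Fin 2) (Fin 2) ℝ := !![1, x; 0, 1]

/-- The dilation matrix `((q,0),(0,1))`. -/
def dilation (q : ℝ) : Matrix (Fin 2) (Fin 2) ℝ := !![q, 0; 0, 1]

theorem det_translation (x : ℝ) : (translation x).det = 1 := by
  simp [translation, Matrix.det_fin_two]

theorem det_dilation (q : ℝ) : (dilation q).det = q := by
  simp [dilation, Matrix.det_fin_two]

theorem slashLin_translation_zero (k : ℤ) (f : ℍ → ℂ) : slashLin k (translation 0) f = f := by
  rw [show translation 0 = 1 by simp [translation, Matrix.one_fin_two], slashLin_one]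

theorem slashLin_translation_add (k : ℤ) (x y : ℝ) (f : ℍ → ℂ) :
    slashLin k (translation y) (slashLin k (translation x) f) =
      slashLin k (translation (x + y)) f := by
  rw [slashLin_mul k (by simp [det_translation]) (by simp [det_translation])]
  congr 1
  simp [translation, add_comm]

theorem slashLin_dilation_one (k : ℤ) (f : ℍ → ℂ) : slashLin k (dilation 1) f = f := by
  rw [show dilation 1 = 1 by simp [dilation, Matrix.one_fin_two], slashLin_one]

theorem slashLin_dilation_mul (k : ℤ) {q r : ℝ} (hq : 0 < q) (hr : 0 < r) (f : ℍ → ℂ) :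
    slashLin k (dilation r) (slashLin k (dilation q) f) = slashLin k (dilation (q * r)) f := by
  rw [slashLin_mul k (by simpa [det_dilation]) (by simpa [det_dilation])]
  congr 1
  simp [dilation]

theorem slashLin_translation_dilation (k : ℤ) {q : ℝ} (hq : 0 < q) (x : ℝ) (f : ℍ → ℂ) :
    slashLin k (translation x) (slashLin k (dilation q) f) =
      slashLin k (dilation q) (slashLin k (translation (q * x)) f) := by
  rw [slashLin_mul k (by simpa [det_dilation]) (by simp [det_translation]),
    slashLin_mul k (by simp [det_translation]) (by simpa [det_dilation])]
  congr 1
  simp [dilation, translation]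

theorem slashLin_translation_intCast {k : ℤ} {f : ℍ → ℂ} (hf : slashLin k (translation 1) f = f)
    (n : ℤ) : slashLin k (translation n) f = f := by
  induction n using Int.induction_on with
  | zero => simpa using slashLin_translation_zero k f
  | succ n ih =>
    push_cast at ih ⊢
    rw [← slashLin_translation_add, ih, hf]
  | pred n ih =>
    have h := slashLin_translation_add k 1 (-(n : ℝ) - 1) f
    rw [hf, show (1 : ℝ) + (-(n : ℝ) - 1) = ((-n : ℤ) : ℝ) by push_cast; ring, ih] at h
    push_cast
    exact h

theorem slashLin_translation_congr {k : ℤ} {f : ℍ → ℂ} (hf : slashLin k (translation 1) f = f)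
    {m : ℕ} [NeZero m] {a b : ℤ} (hab : (a : ZMod m) = b) :
    slashLin k (translation (a / m)) f = slashLin k (translation (b / m)) f := by
  obtain ⟨c, hc⟩ := (ZMod.intCast_eq_intCast_iff_dvd_sub a b m).1 hab
  have hm : (m : ℝ) ≠ 0 := by exact_mod_cast NeZero.ne m
  have hb : (b : ℝ) / m = c + a / m := by
    rw [show b = a + m * c by linarith]
    push_cast
    field_simp
    ring
  rw [hb, ← slashLin_translation_add, slashLin_translation_intCast hf]

theorem slashLin_translation_val {k : ℤ} {f : ℍ → ℂ} (hf : slashLin k (translation 1) f = f)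
    {m : ℕ} [NeZero m] {a : ℤ} {x : ZMod m} (hx : (a : ZMod m) = x) :
    slashLin k (translation (x.val / m)) f = slashLin k (translation (a / m)) f := by
  have h := slashLin_translation_congr hf (m := m) (a := x.val) (b := a) (by simp [hx])
  simpa using h

theorem sum_filter_coprime_eq_sum_units {M : Type*} [AddCommMonoid M] {m : ℕ} [NeZero m]
    {s : Finset ℕ} (hinj : Set.InjOn (Nat.cast : ℕ → ZMod m) s)
    (hsurj : ∀ x : ZMod m, ∃ b ∈ s, (b : ZMod m) = x) {F : ℕ → M} {W : (ZMod m)ˣ → M}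
    (hFW : ∀ b ∈ s.filter (fun b => Nat.Coprime b m), ∀ u : (ZMod m)ˣ,
      (b : ZMod m) = u → F b = W u) :
    ∑ b ∈ s.filter (fun b => Nat.Coprime b m), F b = ∑ u : (ZMod m)ˣ, W u := by
  refine Finset.sum_bij (fun b hb => ZMod.unitOfCoprime b (Finset.mem_filter.1 hb).2)
    (fun _ _ => Finset.mem_univ _) ?_ ?_ ?_
  · intro a ha b hb hab
    exact hinj (Finset.mem_filter.1 ha).1 (Finset.mem_filter.1 hb).1 (congrArg Units.val hab)
  · intro u _
    obtain ⟨b, hb, hbu⟩ := hsurj u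
    have hcop : Nat.Coprime b m := (ZMod.isUnit_iff_coprime b m).1 (hbu ▸ u.isUnit)
    exact ⟨b, Finset.mem_filter.2 ⟨hb, hcop⟩, Units.ext hbu⟩
  · intro b hb
    exact hFW b hb _ rfl

/-- The sum of the translates of a function by `u / m`, for `u` a unit modulo `m`. -/
noncomputable def unitSum (k : ℤ) (m : ℕ) [NeZero m] : (ℍ → ℂ) →ₗ[ℂ] (ℍ → ℂ) :=
  ∑ u : (ZMod m)ˣ, slashLin k (translation ((u : ZMod m).val / m))

theorem unitSum_apply (k : ℤ) (m : ℕ) [NeZero m] (f : ℍ → ℂ) :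
    unitSum k m f = ∑ u : (ZMod m)ˣ, slashLin k (translation ((u : ZMod m).val / m)) f := by
  simp [unitSum]

theorem unitSum_dilation {k : ℤ} {f : ℍ → ℂ} (hf : slashLin k (translation 1) f = f)
    {m : ℕ} [NeZero m] {q : ℕ} (hq : 0 < q) (hqm : Nat.Coprime q m) :
    unitSum k m (slashLin k (dilation q) f) = slashLin k (dilation q) (unitSum k m f) := by
  simp only [unitSum_apply, map_sum]
  rw [← Equiv.sum_comp (Equiv.mulLeft (ZMod.unitOfCoprime q hqm)) fun u : (ZMod m)ˣ =>
    slashLin k (dilation q) (slashLin k (translation ((u : ZMod m).val / m)) f)]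
  refine Finset.sum_congr rfl fun u _ => ?_
  rw [slashLin_translation_dilation k (by exact_mod_cast hq)]
  rw [slashLin_translation_val hf (a := (q : ℤ) * (u : ZMod m).val) (by simp)]
  push_cast
  rw [mul_div_assoc]

theorem unitSum_mul {k : ℤ} {f : ℍ → ℂ} (hf : slashLin k (translation 1) f = f)
    {m n : ℕ} [NeZero m] [NeZero n] [NeZero (m * n)] (hmn : Nat.Coprime m n) :
    unitSum k (m * n) f = unitSum k n (unitSum k m f) := by
  let e : (ZMod (m * n))ˣ ≃ (ZMod m)ˣ × (ZMod n)ˣ :=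
    (Units.mapEquiv (ZMod.chineseRemainder hmn).toMulEquiv).trans MulEquiv.prodUnits
  let s : (ZMod m)ˣ × (ZMod n)ˣ ≃ (ZMod m)ˣ × (ZMod n)ˣ :=
    Equiv.prodCongr (Equiv.mulLeft (ZMod.unitOfCoprime n hmn.symm))
      (Equiv.mulLeft (ZMod.unitOfCoprime m hmn))
  have hval : ∀ w : (ZMod m)ˣ × (ZMod n)ˣ,
      (((n : ℤ) * (w.1 : ZMod m).val + m * (w.2 : ZMod n).val : ℤ) : ZMod (m * n)) =
        (e.symm (s w) : (ZMod (m * n))ˣ) := by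
    intro w
    have h1 : ZMod.chineseRemainder hmn (e.symm (s w) : (ZMod (m * n))ˣ) =
        (((s w).1 : ZMod m), ((s w).2 : ZMod n)) :=
      congrArg (fun t : (ZMod m)ˣ × (ZMod n)ˣ => ((t.1 : ZMod m), (t.2 : ZMod n)))
        (e.apply_symm_apply (s w))
    apply (ZMod.chineseRemainder hmn).injective
    rw [h1, map_intCast]
    ext <;> simp [s]
  have hm : (m : ℝ) ≠ 0 := by exact_mod_cast NeZero.ne m
  have hn : (n : ℝ) ≠ 0 := by exact_mod_cast NeZero.ne n
  simp only [unitSum_apply, map_sum]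
  rw [← Equiv.sum_comp (s.trans e.symm), Fintype.sum_prod_type]
  refine Finset.sum_congr rfl fun u _ => Finset.sum_congr rfl fun v _ => ?_
  rw [slashLin_translation_add, Equiv.trans_apply, slashLin_translation_val hf (hval (u, v))]
  congr 2
  push_cast
  field_simp

/-- The sum of the translates of a function by `b / n`, for `0 ≤ b < n`. -/
noncomputable def rangeSum (k : ℤ) (n : ℕ) : (ℍ → ℂ) →ₗ[ℂ] (ℍ → ℂ) :=
  ∑ b ∈ Finset.range n, slashLin k (translation (b / n))

theorem rangeSum_apply (k : ℤ) (n : ℕ) (f : ℍ → ℂ) :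
    rangeSum k n f = ∑ b ∈ Finset.range n, slashLin k (translation (b / n)) f := by
  simp [rangeSum]

theorem sum_range_mul_eq {M : Type*} [AddCommMonoid M] (F : ℕ → M) (n p : ℕ) :
    ∑ i ∈ Finset.range (n * p), F i =
      ∑ b ∈ Finset.range n, ∑ c ∈ Finset.range p, F (n * c + b) := by
  induction p with
  | zero => simp
  | succ p ih =>
    rw [Nat.mul_succ, Finset.sum_range_add, ih, ← Finset.sum_add_distrib]
    simp_rw [Finset.sum_range_succ]

theorem rangeSum_mul (k : ℤ) {n p : ℕ} (hn : 0 < n) (hp : 0 < p) (f : ℍ → ℂ) :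
    rangeSum k (n * p) f =
      ∑ b ∈ Finset.range n, slashLin k (translation (b / (n * p))) (rangeSum k p f) := by
  have hn' : (n : ℝ) ≠ 0 := by positivity
  have hp' : (p : ℝ) ≠ 0 := by positivity
  simp only [rangeSum_apply, map_sum]
  rw [sum_range_mul_eq]
  refine Finset.sum_congr rfl fun b _ => Finset.sum_congr rfl fun c _ => ?_
  rw [slashLin_translation_add]
  congr 2
  push_cast
  field_simp

theorem sum_range_translation_mul {k : ℤ} {f : ℍ → ℂ} (hf : slashLin k (translation 1) f = f)
    {n : ℕ} (hn : 0 < n) (p : ℕ) :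
    ∑ b ∈ Finset.range (n * p), slashLin k (translation (b / n)) f = (p : ℂ) • rangeSum k n f := by
  have hn' : (n : ℝ) ≠ 0 := by positivity
  rw [sum_range_mul_eq, rangeSum_apply, Finset.smul_sum]
  refine Finset.sum_congr rfl fun b _ => ?_
  have : ∀ c ∈ Finset.range p, slashLin k (translation ((n * c + b : ℕ) / n)) f =
      slashLin k (translation (b / n)) f := by
    intro c _
    have hc := slashLin_translation_intCast hf c
    conv_rhs => rw [← hc, slashLin_translation_add]
    congr 2
    push_cast
    field_simp
  rw [Finset.sum_congr rfl this]
  simp [Nat.cast_smul_eq_nsmul]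

theorem rangeSum_mul_mul {k : ℤ} {f : ℍ → ℂ} (hf : slashLin k (translation 1) f = f)
    {p : ℕ} (hp : 0 < p) {α : ℂ}
    (hα : rangeSum k p f = α • slashLin k (dilation p) f - slashLin k (dilation (p ^ 2)) f)
    {n : ℕ} (hn : 0 < n) :
    rangeSum k (n * p * p) f = α • slashLin k (dilation p) (rangeSum k (n * p) f) -
      (p : ℂ) • slashLin k (dilation (p ^ 2)) (rangeSum k n f) := by
  have hn' : (n : ℝ) ≠ 0 := by positivity
  have hp' : (p : ℝ) ≠ 0 := by positivity
  have hp₀ : (0 : ℝ) < p := by positivity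
  rw [rangeSum_mul k (Nat.mul_pos hn hp) hp, hα, ← map_smul (slashLin k (dilation (p ^ 2))),
    ← sum_range_translation_mul hf hn, rangeSum_apply]
  simp only [map_sub, map_smul, map_sum, Finset.smul_sum]
  rw [← Finset.sum_sub_distrib]
  refine Finset.sum_congr rfl fun b _ => ?_
  rw [slashLin_translation_dilation k hp₀, slashLin_translation_dilation k (pow_pos hp₀ 2)]
  congr 4 <;> · push_cast; field_simp

theorem rangeSum_prime_pow {k : ℤ} {f : ℍ → ℂ} (hf : slashLin k (translation 1) f = f)
    {p : ℕ} (hp : 0 < p) {α : ℂ}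
    (hα : rangeSum k p f = α • slashLin k (dilation p) f - slashLin k (dilation (p ^ 2)) f)
    (r : ℕ) : ∃ x y z : ℂ, x = α * y - p * z ∧
      rangeSum k (p ^ r) f = y • slashLin k (dilation (p ^ r)) f -
        z • slashLin k (dilation (p ^ (r + 1))) f ∧
      rangeSum k (p ^ (r + 1)) f = x • slashLin k (dilation (p ^ (r + 1))) f -
        y • slashLin k (dilation (p ^ (r + 2))) f := by
  have hp₀ : (0 : ℝ) < p := by positivity
  induction r with
  | zero =>
    refine ⟨α, 1, 0, by simp, ?_, ?_⟩
    · simp [rangeSum_apply, slashLin_translation_zero, slashLin_dilation_one]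
    · simpa using hα
  | succ r ih =>
    obtain ⟨x, y, z, hx, h1, h2⟩ := ih
    refine ⟨α * x - p * y, x, y, rfl, h2, ?_⟩
    have h := rangeSum_mul_mul hf hp hα (pow_pos hp r)
    rw [← pow_succ, ← pow_succ, h1, h2] at h
    rw [h]
    simp only [map_sub, map_smul]
    rw [slashLin_dilation_mul k (by positivity) (by positivity),
      slashLin_dilation_mul k (by positivity) (by positivity),
      slashLin_dilation_mul k (by positivity) (by positivity),
      slashLin_dilation_mul k (by positivity) (by positivity),
      ← pow_succ, ← pow_succ, ← pow_add, ← pow_add, show r + 1 + 2 = r + 3 by ring,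
      show r + 2 + 1 = r + 3 by ring, show r + 1 + 1 = r + 2 by ring, hx]
    module

theorem unitSum_prime_pow {k : ℤ} {f : ℍ → ℂ} (hf : slashLin k (translation 1) f = f)
    {p : ℕ} (hp : p.Prime) (r : ℕ) [NeZero (p ^ (r + 1))] :
    unitSum k (p ^ (r + 1)) f = rangeSum k (p ^ (r + 1)) f - rangeSum k (p ^ r) f := by
  have hp₀ : (p : ℝ) ≠ 0 := by exact_mod_cast hp.ne_zero
  rw [eq_sub_iff_add_eq, unitSum_apply, rangeSum_apply, rangeSum_apply]
  rw [← sum_filter_coprime_eq_sum_units (s := Finset.range (p ^ (r + 1)))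
    (F := fun b => slashLin k (translation (b / (p ^ (r + 1) : ℕ))) f)
    (W := fun u : (ZMod (p ^ (r + 1)))ˣ =>
      slashLin k (translation ((u : ZMod (p ^ (r + 1))).val / (p ^ (r + 1) : ℕ))) f),
    ← Finset.sum_filter_add_sum_filter_not (Finset.range (p ^ (r + 1)))
      (fun b => Nat.Coprime b (p ^ (r + 1)))]
  · congr 1
    refine Finset.sum_bij (fun b _ => p * b) ?_ ?_ ?_ ?_
    · intro b hb
      rw [Finset.mem_range] at hb
      rw [Finset.mem_filter, Finset.mem_range, pow_succ', Nat.mul_lt_mul_left hp.pos]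
      exact ⟨hb, fun h => hp.one_lt.ne' (Nat.Coprime.eq_one_of_dvd
        (Nat.Coprime.coprime_mul_right_right (Nat.Coprime.coprime_mul_right h)) dvd_rfl)⟩
    · intro a _ b _ hab
      exact Nat.eq_of_mul_eq_mul_left hp.pos hab
    · intro b hb
      rw [Finset.mem_filter, Finset.mem_range, Nat.coprime_pow_right_iff r.succ_pos,
        Nat.coprime_comm, hp.coprime_iff_not_dvd, not_not] at hb
      obtain ⟨hb, c, rfl⟩ := hb
      rw [pow_succ', Nat.mul_lt_mul_left hp.pos] at hb
      exact ⟨c, Finset.mem_range.2 hb, rfl⟩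
    · intro b _
      congr 2
      push_cast
      rw [pow_succ', mul_div_mul_left _ _ hp₀]
  · intro a ha b hb hab
    rw [Finset.coe_range, Set.mem_Iio] at ha hb
    rwa [ZMod.natCast_eq_natCast_iff', Nat.mod_eq_of_lt ha, Nat.mod_eq_of_lt hb] at hab
  · exact fun x => ⟨x.val, Finset.mem_range.2 (ZMod.val_lt x), ZMod.natCast_zmod_val x⟩
  · intro b hb u hbu
    rw [slashLin_translation_val hf (a := b) (by simpa using hbu)]
    simp

theorem rangeSum_of_heckeT {k : ℤ} (hk : Even k) {f : ℍ → ℂ} {p : ℕ} (hp : 0 < p) {α : ℂ}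
    (hα : heckeT k p f = fun z => α * f z) :
    rangeSum k p f = α • slashLin k (dilation p) f - slashLin k (dilation (p ^ 2)) f := by
  have hp₀ : (0 : ℝ) < p := by positivity
  have hmat : ∀ b : ℕ, !![1, (b : ℝ); 0, (p : ℝ)] =
      (p : ℝ) • (translation (b / p) * dilation (p : ℝ)⁻¹) := by
    intro b
    simp only [translation, dilation, Matrix.mul_fin_two, Matrix.smul_of, Matrix.smul_cons,
      smul_eq_mul, Matrix.smul_empty]
    congr! 4 <;> field_simp <;> simp
  have h : slashLin k (dilation p) f + slashLin k (dilation (p : ℝ)⁻¹) (rangeSum k p f) =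
      α • f := by
    ext z
    have hz := congrFun hα z
    rw [heckeT] at hz
    simp only [Pi.add_apply, Pi.smul_apply, smul_eq_mul, ← hz, rangeSum_apply, map_sum,
      Finset.sum_apply]
    congr 1
    refine Finset.sum_congr rfl fun b _ => ?_
    rw [slashLin_mul k (by simp [det_translation]) (by simpa [det_dilation]),
      ← slashLin_smul_matrix hk hp₀.ne' (by simp [det_translation, det_dilation, hp]), ← hmat]
    rfl
  have h' := congrArg (slashLin k (dilation p)) h
  rw [map_add, map_smul, slashLin_dilation_mul k hp₀ hp₀,
    slashLin_dilation_mul k (inv_pos.2 hp₀) hp₀, inv_mul_cancel₀ hp₀.ne',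
    slashLin_dilation_one, ← sq] at h'
  rw [← h']
  abel

/-- The Fricke matrix `((0,-1),(N,0))`. -/
def fricke (N : ℝ) : Matrix (Fin 2) (Fin 2) ℝ := !![0, -1; N, 0]

theorem det_fricke (N : ℝ) : (fricke N).det = N := by
  simp [fricke, Matrix.det_fin_two]

theorem slashLin_fricke_dilation {k : ℤ} (hk : Even k) {N q : ℝ} (hN : 0 < N) (hq : 0 < q)
    (f : ℍ → ℂ) : slashLin k (fricke N) (slashLin k (dilation q) f) =
      slashLin k (dilation q⁻¹) (slashLin k (fricke N) f) := by
  have hq' : 0 < q⁻¹ := inv_pos.2 hq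
  have hmat : dilation q * fricke N = q • (fricke N * dilation q⁻¹) := by
    simp [dilation, fricke, mul_left_comm, hq.ne']
  rw [slashLin_mul k (by simpa [det_dilation]) (by simpa [det_fricke]),
    slashLin_mul k (by simpa [det_fricke]) (by simpa [det_dilation]), hmat,
    slashLin_smul_matrix hk hq.ne' (by rw [Matrix.det_mul, det_fricke, det_dilation]; positivity)]

theorem unitSum_prime_pow_of_heckeT {k : ℤ} (hk : Even k) {f : ℍ → ℂ}
    (hf : slashLin k (translation 1) f = f) {p : ℕ} (hp : p.Prime) {α : ℂ}
    (hα : heckeT k p f = fun z => α * f z) (r : ℕ) [NeZero (p ^ (r + 1))] :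
    ∃ s t : ℂ, unitSum k (p ^ (r + 1)) f = s • slashLin k (dilation (p ^ (r + 1) : ℕ)) f +
      t • (slashLin k (dilation (p ^ (r + 2) : ℕ)) f + slashLin k (dilation (p ^ r : ℕ)) f) := by
  obtain ⟨x, y, z, -, h1, h2⟩ :=
    rangeSum_prime_pow hf hp.pos (rangeSum_of_heckeT hk hp.pos hα) r
  refine ⟨x + z, -y, ?_⟩
  rw [unitSum_prime_pow hf hp, h1, h2]
  push_cast
  module

theorem slashLin_fricke_unitSum {k : ℤ} (hk : Even k) {f : ℍ → ℂ}
    (hf : slashLin k (translation 1) f = f) {N : ℝ} (hN : 0 < N) {ε : ℂ}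
    (hH : slashLin k (fricke N) f = ε • f) (m : ℕ) [NeZero m]
    (hT : ∀ p : ℕ, p.Prime → p ∣ m → ∃ α : ℂ, heckeT k p f = fun z => α * f z) :
    slashLin k (fricke N) (slashLin k (dilation (m : ℝ)⁻¹) (unitSum k m f)) =
      ε • slashLin k (dilation (m : ℝ)⁻¹) (unitSum k m f) := by
  rename_i hm
  revert hm
  induction m using Nat.recOnPrimePow with
  | zero => intro hm; exact absurd rfl hm.out
  | one =>
    intro _
    have h1 : unitSum k 1 f = f := by
      rw [unitSum_apply, Fintype.sum_unique,
        slashLin_translation_val hf (a := 0) (Subsingleton.elim _ _)]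
      simpa using slashLin_translation_zero k f
    simpa [h1, slashLin_dilation_one] using hH
  | prime_pow_mul a p n hp hpa hn ih =>
    intro _
    obtain ⟨r, rfl⟩ := Nat.exists_eq_add_one_of_ne_zero hn.ne'
    have ha₀ : a ≠ 0 := by rintro rfl; simp at hpa
    have : NeZero a := ⟨ha₀⟩
    have : NeZero (p ^ (r + 1)) := ⟨pow_ne_zero _ hp.ne_zero⟩
    have hpcop : Nat.Coprime p a := hp.coprime_iff_not_dvd.2 hpa
    have ha : (0 : ℝ) < a := by exact_mod_cast Nat.pos_of_ne_zero ha₀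
    have hp₀ : (0 : ℝ) < p := by exact_mod_cast hp.pos
    obtain ⟨α, hα⟩ := hT p hp ((dvd_pow_self p r.succ_ne_zero).mul_right a)
    have hG := ih fun q hq hqa => hT q hq (hqa.mul_left _)
    obtain ⟨s, t, hst⟩ := unitSum_prime_pow_of_heckeT hk hf hp hα r
    set G := slashLin k (dilation (a : ℝ)⁻¹) (unitSum k a f) with hGdef
    have hrepr : slashLin k (dilation ((p ^ (r + 1) * a : ℕ) : ℝ)⁻¹)
        (unitSum k (p ^ (r + 1) * a) f) = s • G +
          t • (slashLin k (dilation p) G + slashLin k (dilation (p : ℝ)⁻¹) G) := by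
      rw [unitSum_mul hf (hpcop.pow_left _), hst]
      simp only [map_add, map_smul]
      rw [unitSum_dilation hf (pow_pos hp.pos _) (hpcop.pow_left _),
        unitSum_dilation hf (pow_pos hp.pos _) (hpcop.pow_left _),
        unitSum_dilation hf (pow_pos hp.pos _) (hpcop.pow_left _), hGdef]
      push_cast
      rw [slashLin_dilation_mul k (by positivity) (by positivity),
        slashLin_dilation_mul k (by positivity) (by positivity),
        slashLin_dilation_mul k (by positivity) (by positivity),
        slashLin_dilation_mul k (by positivity) (by positivity),
        slashLin_dilation_mul k (by positivity) (by positivity)]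
      rw [show (p : ℝ) ^ (r + 1) * (p ^ (r + 1) * a : ℝ)⁻¹ = (a : ℝ)⁻¹ by field_simp,
        show (p : ℝ) ^ (r + 2) * (p ^ (r + 1) * a : ℝ)⁻¹ = (a : ℝ)⁻¹ * p by field_simp; ring,
        show (p : ℝ) ^ r * (p ^ (r + 1) * a : ℝ)⁻¹ = (a : ℝ)⁻¹ * (p : ℝ)⁻¹ by
          field_simp; ring]
    rw [hrepr]
    simp only [map_add, map_smul]
    rw [slashLin_fricke_dilation hk hN hp₀, slashLin_fricke_dilation hk hN (inv_pos.2 hp₀),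
      inv_inv, hG, map_smul, map_smul]
    module

theorem slashLin_lower {k : ℤ} (hk : Even k) {N : ℝ} (hN : 0 < N) {m : ℝ} (hm : 0 < m) (c : ℝ)
    (f : ℍ → ℂ) :
    slashLin k (dilation m) (slashLin k (fricke N) (slashLin k (dilation m⁻¹)
      (slashLin k (translation (c / m)) (slashLin k (fricke N) f)))) =
      slashLin k !![m, 0; -(N * c), 1 / m] f := by
  have hm' : 0 < m⁻¹ := inv_pos.2 hm
  have hmat : fricke N * translation (c / m) * dilation m⁻¹ * fricke N * dilation m =
      (-N) • !![m, 0; -(N * c), 1 / m] := by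
    ext i j
    fin_cases i <;> fin_cases j <;> simp [fricke, dilation, translation]
    all_goals field_simp
  have h1 : 0 < (fricke N * translation (c / m)).det := by
    rw [Matrix.det_mul, det_fricke, det_translation]; positivity
  have h2 : 0 < (fricke N * translation (c / m) * dilation m⁻¹).det := by
    rw [Matrix.det_mul, det_dilation]; positivity
  have h3 : 0 < (fricke N * translation (c / m) * dilation m⁻¹ * fricke N).det := by
    rw [Matrix.det_mul, det_fricke]; positivity
  rw [slashLin_mul k (A := fricke N) (B := translation (c / m)) (by rwa [det_fricke])
      (by simp [det_translation]),
    slashLin_mul k h1 (by rwa [det_dilation]), slashLin_mul k h2 (by rwa [det_fricke]),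
    slashLin_mul k h3 (by rwa [det_dilation]), hmat,
    slashLin_smul_matrix hk (neg_ne_zero.2 hN.ne') (by simp [Matrix.det_fin_two, hm.ne'])]

theorem natCast_injOn_Icc (m : ℕ) :
    Set.InjOn (Nat.cast : ℕ → ZMod m) (Finset.Icc 1 m : Finset ℕ) := by
  intro a ha b hb hab
  rw [Finset.coe_Icc, Set.mem_Icc] at ha hb
  obtain ⟨c, hc⟩ := (ZMod.intCast_eq_intCast_iff_dvd_sub a b m).1 (by simpa using hab)
  have h1 : (m : ℤ) * c < m * 1 := by omega
  have h2 : (m : ℤ) * (-1) < m * c := by omega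
  have hm : (0 : ℤ) < m := by omega
  have h3 := lt_of_mul_lt_mul_left h1 hm.le
  have h4 := lt_of_mul_lt_mul_left h2 hm.le
  obtain rfl : c = 0 := by omega
  omega

theorem exists_mem_Icc_natCast_eq {m : ℕ} [NeZero m] (x : ZMod m) :
    ∃ b ∈ Finset.Icc 1 m, (b : ZMod m) = x := by
  by_cases hx : x.val = 0
  · exact ⟨m, Finset.mem_Icc.2 ⟨NeZero.one_le, le_rfl⟩, by
      simpa using ((ZMod.val_eq_zero x).1 hx).symm⟩
  · exact ⟨x.val, Finset.mem_Icc.2 ⟨Nat.one_le_iff_ne_zero.2 hx, (ZMod.val_lt x).le⟩,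
      ZMod.natCast_zmod_val x⟩

/-- **Corollary 2.** Under the hypotheses of Theorem 2 (with `gcd(m,N) = 1`),
for any choice of integers `c_b, n_b` with `m·n_b − b·c_b·N = 1` and
`γ_b = ((m,−b),(−Nc_b,n_b)) ∈ Γ₀(N)` one has
`Σ'_{b (m)} [ f|_k β(b/m) − f|_k (γ_b β(b/m)) ] = 0`. -/
theorem corollary_two
    (N : ℕ) (hNpos : 0 < N) (m : ℕ) (hmpos : 0 < m) (hmN : Nat.Coprime m N)
    (k : ℤ) (hkpos : 0 < k) (hkeven : Even k)
    (f : ℍ → ℂ) (ε : ℝ) (hε : ε = 1 ∨ ε = -1)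
    (hP : slash k !![1, 1; 0, 1] f = f)
    (hH : slash k !![0, -1; (N : ℝ), 0] f = fun z => (ε : ℂ) * f z)
    (hT : ∀ p : ℕ, p.Prime → p ∣ m → ∃ α : ℂ, heckeT k p f = fun z => α * f z)
    (cc nn : ℕ → ℤ)
    (hdet : ∀ b ∈ (Finset.Icc 1 m).filter (fun b => Nat.Coprime b m),
      (m : ℤ) * nn b - (b : ℤ) * cc b * (N : ℤ) = 1) :
    (fun z => ∑ b ∈ (Finset.Icc 1 m).filter (fun b => Nat.Coprime b m),
      (slash k !![1, (b : ℝ) / (m : ℝ); 0, 1] f z -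
        slash k (!![(m : ℝ), -(b : ℝ); -((N : ℝ) * (cc b : ℝ)), (nn b : ℝ)] *
          !![1, (b : ℝ) / (m : ℝ); 0, 1]) f z)) = (0 : ℍ → ℂ) := by
  have : NeZero m := ⟨hmpos.ne'⟩
  have hN : (0 : ℝ) < N := by exact_mod_cast hNpos
  have hm : (0 : ℝ) < m := by exact_mod_cast hmpos
  have hf : slashLin k (translation 1) f = f := hP
  have hfr : slashLin k (fricke N) f = (ε : ℂ) • f := hH
  have hε2 : (ε : ℂ) * ε = 1 := by rcases hε with rfl | rfl <;> norm_num
  have hsym := congrArg (slashLin k (dilation m))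
    (slashLin_fricke_unitSum hkeven hf hN hfr m hT)
  rw [map_smul, slashLin_dilation_mul k (inv_pos.2 hm) hm, inv_mul_cancel₀ hm.ne',
    slashLin_dilation_one] at hsym
  have hfirst : ∑ b ∈ (Finset.Icc 1 m).filter (fun b => Nat.Coprime b m),
      slashLin k (translation (b / m)) f = unitSum k m f := by
    rw [unitSum_apply]
    refine sum_filter_coprime_eq_sum_units (natCast_injOn_Icc m) exists_mem_Icc_natCast_eq
      fun b _ u hbu => ?_
    rw [slashLin_translation_val hf (a := b) (by simpa using hbu), Int.cast_natCast]
  have hsecond : ∑ b ∈ (Finset.Icc 1 m).filter (fun b => Nat.Coprime b m),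
      slashLin k (translation (cc b / m)) f = unitSum k m f := by
    let ν : (ZMod m)ˣ := ZMod.unitOfCoprime N hmN.symm
    let e : (ZMod m)ˣ ≃ (ZMod m)ˣ :=
      ((Equiv.mulRight ν).trans (Equiv.inv _)).trans (Equiv.neg _)
    have he : ∀ u : (ZMod m)ˣ, (u : ZMod m) * (e u : (ZMod m)ˣ) * N = -1 := by
      intro u
      have h : u * e u * ν = -1 := by
        simp only [e, Equiv.trans_apply, Equiv.coe_mulRight, Equiv.inv_apply, Equiv.neg_apply]
        rw [mul_neg, neg_mul, mul_right_comm, mul_inv_cancel]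
      simpa [ν] using congrArg Units.val h
    rw [unitSum_apply, ← Equiv.sum_comp e fun u : (ZMod m)ˣ =>
      slashLin k (translation ((u : ZMod m).val / m)) f]
    refine sum_filter_coprime_eq_sum_units (natCast_injOn_Icc m) exists_mem_Icc_natCast_eq
      fun b hb u hbu => ?_
    have hd := congrArg (Int.cast : ℤ → ZMod m) (hdet b hb)
    push_cast at hd
    rw [ZMod.natCast_self, zero_mul, zero_sub, neg_eq_iff_eq_neg, hbu, ← he u] at hd
    have hc : (cc b : ZMod m) = e u := u.isUnit.mul_left_cancel (ν.isUnit.mul_right_cancel hd)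
    rw [slashLin_translation_val hf hc]
  have hlower : ∀ b : ℕ, b ∈ (Finset.Icc 1 m).filter (fun b => Nat.Coprime b m) →
      slashLin k (!![(m : ℝ), -(b : ℝ); -((N : ℝ) * (cc b : ℝ)), (nn b : ℝ)] *
          !![1, (b : ℝ) / (m : ℝ); 0, 1]) f =
        (ε : ℂ) • slashLin k (dilation m) (slashLin k (fricke N) (slashLin k (dilation (m : ℝ)⁻¹)
          (slashLin k (translation (cc b / m)) f))) := by
    intro b hb
    have hd : (m : ℝ) * nn b - b * cc b * N = 1 := by exact_mod_cast hdet b hb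
    rw [← map_smul, ← map_smul, ← map_smul, ← map_smul, ← hfr, slashLin_lower hkeven hN hm]
    congr 2
    ext i j
    fin_cases i <;> fin_cases j <;> simp <;> field_simp <;> linarith
  funext z
  trans (∑ b ∈ (Finset.Icc 1 m).filter (fun b => Nat.Coprime b m),
    (slashLin k (translation (b / m)) f - slashLin k
      (!![(m : ℝ), -(b : ℝ); -((N : ℝ) * (cc b : ℝ)), (nn b : ℝ)] *
          !![1, (b : ℝ) / (m : ℝ); 0, 1]) f)) z
  · rw [Finset.sum_apply]
    rfl
  rw [Finset.sum_sub_distrib, hfirst, Finset.sum_congr rfl hlower, ← Finset.smul_sum, ← map_sum,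
    ← map_sum, ← map_sum, hsecond, hsym, smul_smul, hε2, one_smul, sub_self]
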